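/- Let (f_n) be the integer sequence defined by f_0 = 0, f_1 = 1 and f_n = Σ_{i=1}^{n−1} (2^i C_i − f_i) f_{n−i} for n ≥ 2, where C_i = (1/i)·binomial(2i−2, i−1). Then f_n is asymptotically equivalent to ((3 − √3)/6) · 2^{3n−2}/√(π n³) as n → ∞; that is, f_n · 6 √(π n³) / ((3 − √3) · 2^{3n−2}) tends to 1 as n → ∞. -/

import Mathlib

/-- The Catalan number `C n = (1/n) * binomial (2n-2) (n-1)` (the division is exact;
`C 0 = 0`). -/
def catalanC (n : ℕ) : ℕ := (2 * n - 2).choose (n - 1) / n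

/-- The power series `c` with `c = X + c ^ 2`, the generating function of the shifted Catalan
numbers. -/
noncomputable def shiftedCatalan : PowerSeries ℝ :=
  PowerSeries.mk fun n => (catalanC n : ℝ)

lemma catalanC_zero : catalanC 0 = 0 := by simp [catalanC]

lemma catalanC_succ (n : ℕ) : catalanC (n + 1) = catalan n := by
  rw [catalan_eq_centralBinom_div, Nat.centralBinom_eq_two_mul_choose]
  simp [catalanC, Nat.mul_add]

lemma succ_mul_catalanC_succ (n : ℕ) :
    ((n : ℝ) + 1) * catalanC (n + 1) = n.centralBinom := by
  rw [catalanC_succ]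
  exact_mod_cast succ_mul_catalan_eq_centralBinom n

lemma catalanC_succ_pos (n : ℕ) : (0 : ℝ) < catalanC (n + 1) := by
  have h := succ_mul_catalanC_succ n
  have h' : (0 : ℝ) < n.centralBinom := by exact_mod_cast n.centralBinom_pos
  rw [← h] at h'
  exact pos_of_mul_pos_right h' (by positivity)

lemma coeff_shiftedCatalan (n : ℕ) :
    PowerSeries.coeff n shiftedCatalan = catalanC n := by
  simp [shiftedCatalan]

lemma constantCoeff_shiftedCatalan : PowerSeries.constantCoeff shiftedCatalan = 0 := by
  rw [← PowerSeries.coeff_zero_eq_constantCoeff_apply, coeff_shiftedCatalan, catalanC_zero]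
  simp

lemma shiftedCatalan_eq :
    shiftedCatalan = PowerSeries.X + shiftedCatalan ^ 2 := by
  have hS : shiftedCatalan
      = PowerSeries.X * PowerSeries.map (Nat.castRingHom ℝ) PowerSeries.catalanSeries := by
    ext n
    cases n with
    | zero => simp [coeff_shiftedCatalan, catalanC_zero]
    | succ n => simp [coeff_shiftedCatalan, catalanC_succ, PowerSeries.coeff_succ_X_mul]
  have h := congrArg (PowerSeries.map (Nat.castRingHom ℝ))
    PowerSeries.catalanSeries_sq_mul_X_add_one
  simp only [map_add, map_mul, map_pow, map_one, PowerSeries.map_X] at h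
  rw [hS]
  linear_combination -PowerSeries.X * h

lemma coeff_shiftedCatalan_pow_add_two (n k : ℕ) :
    PowerSeries.coeff (n + 1) (shiftedCatalan ^ (k + 2))
      = PowerSeries.coeff (n + 1) (shiftedCatalan ^ (k + 1))
        - PowerSeries.coeff n (shiftedCatalan ^ k) := by
  have h : shiftedCatalan ^ (k + 2)
      = shiftedCatalan ^ (k + 1) - PowerSeries.X * shiftedCatalan ^ k := by
    linear_combination -shiftedCatalan ^ k * shiftedCatalan_eq
  rw [h, map_sub, PowerSeries.coeff_succ_X_mul]

lemma coeff_shiftedCatalan_pow_nonneg (n k : ℕ) :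
    0 ≤ PowerSeries.coeff n (shiftedCatalan ^ k) := by
  rw [PowerSeries.coeff_pow]
  exact Finset.sum_nonneg fun l _ => Finset.prod_nonneg fun i _ => by
    rw [coeff_shiftedCatalan]; positivity

lemma coeff_shiftedCatalan_pow_succ_le (n k : ℕ) :
    PowerSeries.coeff (n + 1) (shiftedCatalan ^ (k + 1)) ≤ catalanC (n + 1) := by
  induction k with
  | zero => simp [coeff_shiftedCatalan]
  | succ k ih =>
    rw [coeff_shiftedCatalan_pow_add_two]
    linarith [coeff_shiftedCatalan_pow_nonneg n k]

open Filter Topology in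
lemma tendsto_catalanC_ratio :
    Tendsto (fun n : ℕ => (catalanC (n + 1) : ℝ) / catalanC (n + 2)) atTop (𝓝 (1 / 4)) := by
  have h (n : ℕ) : (catalanC (n + 1) : ℝ) / catalanC (n + 2)
      = 1 / 4 + 3 / 8 * (1 / ((n : ℝ) + 1 / 2)) := by
    have h1 := succ_mul_catalanC_succ n
    have h2 := succ_mul_catalanC_succ (n + 1)
    have h3 : ((n : ℝ) + 1) * (n + 1).centralBinom = 2 * (2 * n + 1) * n.centralBinom := by
      exact_mod_cast Nat.succ_mul_centralBinom_succ n
    rw [← h1, ← h2] at h3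
    push_cast at h3
    have h4 := catalanC_succ_pos (n + 1)
    have h5 : (n : ℝ) + 1 ≠ 0 := by positivity
    have h6 : (n : ℝ) + 1 / 2 ≠ 0 := by positivity
    have h7 : ((n : ℝ) + 2) * catalanC (n + 2) = 2 * (2 * n + 1) * catalanC (n + 1) := by
      apply mul_left_cancel₀ h5
      linear_combination h3
    rw [div_eq_iff h4.ne']
    field_simp
    linear_combination -16 * h7
  simp_rw [h]
  have : Tendsto (fun n : ℕ => 1 / ((n : ℝ) + 1 / 2)) atTop (𝓝 0) :=
    tendsto_const_nhds.div_atTop (tendsto_natCast_atTop_atTop.atTop_add tendsto_const_nhds)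
  have hlim := (this.const_mul (3 / 8 : ℝ)).const_add (1 / 4)
  rwa [mul_zero, add_zero] at hlim

open Filter Topology in
lemma tendsto_coeff_shiftedCatalan_pow_div (k : ℕ) :
    Tendsto (fun n : ℕ => PowerSeries.coeff (n + 1) (shiftedCatalan ^ k) / catalanC (n + 1))
      atTop (𝓝 (2 * k / 2 ^ k)) := by
  induction k using Nat.twoStepInduction with
  | zero => simp [PowerSeries.coeff_one]
  | one =>
    have h (n : ℕ) : PowerSeries.coeff (n + 1) (shiftedCatalan ^ 1) / (catalanC (n + 1) : ℝ)
        = 1 := by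
      rw [pow_one, coeff_shiftedCatalan, div_self (catalanC_succ_pos n).ne']
    simp_rw [h]
    simp
  | more k ih₀ ih₁ =>
    rw [← tendsto_add_atTop_iff_nat 1] at ih₁ ⊢
    convert ih₁.sub (ih₀.mul tendsto_catalanC_ratio) using 2 with n
    · have h₁ := (catalanC_succ_pos n).ne'
      have h₂ := (catalanC_succ_pos (n + 1)).ne'
      rw [coeff_shiftedCatalan_pow_add_two]
      field_simp
    · push_cast
      field_simp
      ring

lemma summable_catalanC_div_four_pow :
    Summable fun k : ℕ => (catalanC k : ℝ) * (1 / 4) ^ k := by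
  have key (n : ℕ) : ∑ i ∈ Finset.range n, (catalanC (i + 1) : ℝ) * (1 / 4) ^ (i + 1)
      = 1 / 2 - n.centralBinom / 4 ^ n / 2 := by
    induction n with
    | zero => simp
    | succ n ih =>
      have h1 := succ_mul_catalanC_succ n
      have h3 : ((n : ℝ) + 1) * (n + 1).centralBinom = 2 * (2 * n + 1) * n.centralBinom := by
        exact_mod_cast Nat.succ_mul_centralBinom_succ n
      have h5 : (n : ℝ) + 1 ≠ 0 := by positivity
      have h6 : ((n + 1).centralBinom : ℝ) = 2 * (2 * n + 1) * catalanC (n + 1) := by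
        apply mul_left_cancel₀ h5
        linear_combination h3 - 2 * (2 * n + 1) * h1
      rw [Finset.sum_range_succ, ih, h6, ← h1]
      simp only [one_div, inv_pow, pow_succ]
      field_simp
      ring
  rw [← summable_nat_add_iff 1]
  refine summable_of_sum_range_le (c := 1 / 2) (fun n => by positivity) fun n => ?_
  rw [key]
  have : (0 : ℝ) ≤ n.centralBinom / 4 ^ n / 2 := by positivity
  linarith

lemma sum_antidiagonal_centralBinom_mul (n : ℕ) :
    ∑ ij ∈ Finset.HasAntidiagonal.antidiagonal n, (ij.1.centralBinom : ℝ) * ij.2.centralBinom = 4 ^ n := by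
  set B : PowerSeries ℝ := PowerSeries.mk fun n => (n.centralBinom : ℝ) with hB
  have hder : PowerSeries.derivative ℝ shiftedCatalan = B := by
    ext n
    rw [PowerSeries.coeff_derivative, coeff_shiftedCatalan, hB, PowerSeries.coeff_mk,
      ← succ_mul_catalanC_succ, mul_comm]
  have h1 : B = 1 + 2 * shiftedCatalan * B := by
    have h := congrArg (PowerSeries.derivative ℝ) shiftedCatalan_eq
    rw [map_add, Derivation.leibniz_pow, hder] at h
    simp at h
    linear_combination h
  have h2 : B ^ 2 = 1 + PowerSeries.X * (4 * B ^ 2) := by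
    linear_combination 4 * B ^ 2 * shiftedCatalan_eq
      + (1 + (1 - 2 * shiftedCatalan) * B) * h1
  have h3 : ∑ ij ∈ Finset.HasAntidiagonal.antidiagonal n, (ij.1.centralBinom : ℝ) * ij.2.centralBinom
      = PowerSeries.coeff n (B ^ 2) := by
    simp [sq, PowerSeries.coeff_mul, hB]
  rw [h3]
  clear h3
  induction n with
  | zero => rw [h2]; simp
  | succ n ih =>
    rw [h2, map_add, PowerSeries.coeff_succ_X_mul, ← map_ofNat PowerSeries.C 4,
      PowerSeries.coeff_C_mul, ih]
    rw [PowerSeries.coeff_one, if_neg n.succ_ne_zero, zero_add, pow_succ, mul_comm]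

lemma summable_centralBinom_div_sixteen_pow :
    Summable fun n : ℕ => (n.centralBinom : ℝ) * (1 / 16) ^ n := by
  refine Summable.of_nonneg_of_le (fun n => by positivity) (fun n => ?_)
    (summable_geometric_of_lt_one (r := 1 / 4) (by norm_num) (by norm_num))
  have : (n.centralBinom : ℝ) ≤ 4 ^ n := by exact_mod_cast n.centralBinom_le_four_pow
  calc (n.centralBinom : ℝ) * (1 / 16) ^ n ≤ 4 ^ n * (1 / 16) ^ n := by gcongr
    _ = (1 / 4) ^ n := by rw [← mul_pow]; norm_num

lemma tsum_centralBinom_div_sixteen_pow :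
    ∑' n : ℕ, (n.centralBinom : ℝ) * (1 / 16) ^ n = 2 / √3 := by
  have hsum := summable_centralBinom_div_sixteen_pow
  have hsq := tsum_mul_tsum_eq_tsum_sum_antidiagonal_of_summable_norm hsum.norm hsum.norm
  have hconv (n : ℕ) : ∑ kl ∈ Finset.HasAntidiagonal.antidiagonal n,
      (kl.1.centralBinom : ℝ) * (1 / 16) ^ kl.1 * (kl.2.centralBinom * (1 / 16) ^ kl.2)
      = (1 / 4) ^ n := by
    calc _ = ∑ kl ∈ Finset.HasAntidiagonal.antidiagonal n,
          ((kl.1.centralBinom : ℝ) * kl.2.centralBinom) * (1 / 16) ^ n := by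
            refine Finset.sum_congr rfl fun kl hkl => ?_
            rw [← Finset.HasAntidiagonal.mem_antidiagonal.mp hkl, pow_add]
            ring
      _ = (1 / 4) ^ n := by
            rw [← Finset.sum_mul, sum_antidiagonal_centralBinom_mul, ← mul_pow]
            norm_num
  simp_rw [hconv] at hsq
  rw [tsum_geometric_of_lt_one (by norm_num) (by norm_num)] at hsq
  have h0 : 0 ≤ ∑' n : ℕ, (n.centralBinom : ℝ) * (1 / 16) ^ n :=
    tsum_nonneg fun n => by positivity
  refine (sq_eq_sq₀ h0 (by positivity)).mp ?_
  rw [sq, hsq, div_pow, Real.sq_sqrt (by norm_num)]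
  norm_num

open Filter Topology in
lemma tendsto_centralBinom_mul_sqrt_div :
    Tendsto (fun n : ℕ => (n.centralBinom : ℝ) / 4 ^ n * √(Real.pi * (n + 1))) atTop (𝓝 1) := by
  have hs := Stirling.tendsto_stirlingSeq_sqrt_pi
  have h2 : Tendsto (fun n : ℕ => Stirling.stirlingSeq (2 * n)) atTop (𝓝 √Real.pi) :=
    hs.comp (tendsto_id.const_mul_atTop' two_pos)
  have hpi : √Real.pi ≠ 0 := by positivity
  have hq : Tendsto (fun n : ℕ => √(1 + 1 / (n : ℝ))) atTop (𝓝 1) := by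
    have : Tendsto (fun n : ℕ => 1 + 1 / (n : ℝ)) atTop (𝓝 1) := by
      simpa using (tendsto_one_div_atTop_nhds_zero_nat (𝕜 := ℝ)).const_add 1
    simpa using this.sqrt
  have hlim := ((h2.div (hs.pow 2) (pow_ne_zero 2 hpi)).mul_const √Real.pi).mul hq
  have hval : √Real.pi / √Real.pi ^ 2 * √Real.pi * 1 = 1 := by field_simp
  rw [hval] at hlim
  refine hlim.congr' ?_
  filter_upwards [eventually_gt_atTop 0] with n hn
  have hn' : (0 : ℝ) < n := by exact_mod_cast hn
  have hcb : ((2 * n).factorial : ℝ) = n.centralBinom * (n.factorial : ℝ) ^ 2 := by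
    have := Nat.choose_mul_factorial_mul_factorial (n := 2 * n) (k := n) (by omega)
    rw [← Nat.centralBinom_eq_two_mul_choose, show 2 * n - n = n by omega] at this
    rw [← this]; push_cast; ring
  have hsq : √(1 + 1 / (n : ℝ)) = √(n + 1) / √n := by
    rw [← Real.sqrt_div (by positivity)]
    congr 1
    field_simp
  have hs4 : √(2 * ((2 * n : ℕ) : ℝ)) = 2 * √n := by
    rw [show (2 * ((2 * n : ℕ) : ℝ)) = 2 ^ 2 * n by push_cast; ring,
      Real.sqrt_mul (by positivity), Real.sqrt_sq (by positivity)]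
  have hs2 : √(2 * (n : ℝ)) ^ 2 = 2 * √n ^ 2 := by
    rw [Real.sq_sqrt (by positivity), Real.sq_sqrt (by positivity)]
  simp only [Pi.div_apply]
  have hf : (n.factorial : ℝ) ≠ 0 := by positivity
  have hsn : √(n : ℝ) ≠ 0 := by positivity
  have he : ((2 * n : ℕ) / Real.exp 1 : ℝ) ^ (2 * n) = 4 ^ n * ((n / Real.exp 1 : ℝ) ^ n) ^ 2 := by
    rw [← pow_mul, mul_comm n 2, pow_mul, pow_mul, ← mul_pow]
    congr 1
    push_cast
    ring
  have he0 : (n / Real.exp 1 : ℝ) ^ n ≠ 0 := by positivity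
  rw [Stirling.stirlingSeq, Stirling.stirlingSeq, hsq, hs4, hcb, he,
    Real.sqrt_mul Real.pi_pos.le]
  generalize (n / Real.exp 1 : ℝ) ^ n = e at he0
  rw [div_pow, mul_pow, hs2]
  field_simp

/-- The generating function of `2 ^ n * C n`. -/
noncomputable def rowSeries : PowerSeries ℝ := PowerSeries.rescale 2 shiftedCatalan

/-- The power series `G` with `G = A ^ 2 / 4 + G ^ 2`, where `A` is `rowSeries`. -/
noncomputable def gapSeries : PowerSeries ℝ :=
  shiftedCatalan.subst ((1 / 4 : ℝ) • rowSeries ^ 2)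

lemma rowSeries_eq : rowSeries = 2 * PowerSeries.X + rowSeries ^ 2 := by
  have h := congrArg (PowerSeries.rescale (2 : ℝ)) shiftedCatalan_eq
  rw [map_add, map_pow, PowerSeries.rescale_X] at h
  rwa [map_ofNat PowerSeries.C 2] at h

lemma coeff_rowSeries_pow (n k : ℕ) :
    PowerSeries.coeff n (rowSeries ^ k)
      = 2 ^ n * PowerSeries.coeff n (shiftedCatalan ^ k) := by
  rw [rowSeries, ← map_pow, PowerSeries.coeff_rescale]

lemma coeff_rowSeries (n : ℕ) : PowerSeries.coeff n rowSeries = 2 ^ n * catalanC n := by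
  rw [rowSeries, PowerSeries.coeff_rescale, coeff_shiftedCatalan]

lemma constantCoeff_rowSeries : PowerSeries.constantCoeff rowSeries = 0 := by
  rw [← PowerSeries.coeff_zero_eq_constantCoeff_apply, coeff_rowSeries, catalanC_zero]
  simp

lemma hasSubst_rowSeries_sq : PowerSeries.HasSubst ((1 / 4 : ℝ) • rowSeries ^ 2) :=
  PowerSeries.HasSubst.of_constantCoeff_zero' (by
    simp [PowerSeries.smul_eq_C_mul, constantCoeff_rowSeries])

lemma gapSeries_eq : gapSeries = (1 / 4 : ℝ) • rowSeries ^ 2 + gapSeries ^ 2 := by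
  have h := congrArg (PowerSeries.subst ((1 / 4 : ℝ) • rowSeries ^ 2)) shiftedCatalan_eq
  rwa [PowerSeries.subst_add hasSubst_rowSeries_sq, PowerSeries.subst_pow hasSubst_rowSeries_sq,
    PowerSeries.subst_X hasSubst_rowSeries_sq] at h

lemma coeff_gapSeries (n : ℕ) :
    PowerSeries.coeff n gapSeries
      = ∑' k : ℕ, (catalanC k : ℝ) * (1 / 4) ^ k
          * (2 ^ n * PowerSeries.coeff n (shiftedCatalan ^ (2 * k))) := by
  rw [gapSeries, PowerSeries.coeff_subst' hasSubst_rowSeries_sq,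
    ← tsum_eq_finsum (L := SummationFilter.unconditional ℕ)
      (PowerSeries.coeff_subst_finite' hasSubst_rowSeries_sq _ _)]
  refine tsum_congr fun k => ?_
  rw [smul_pow, ← pow_mul, map_smul, coeff_rowSeries_pow, coeff_shiftedCatalan]
  simp only [smul_eq_mul]
  ring

lemma constantCoeff_gapSeries : PowerSeries.constantCoeff gapSeries = 0 := by
  rw [← PowerSeries.coeff_zero_eq_constantCoeff_apply, coeff_gapSeries]
  refine (tsum_congr fun k => ?_).trans tsum_zero
  rcases k with _ | k
  · simp [catalanC_zero]
  · simp [constantCoeff_shiftedCatalan]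

/-- The generating function of the numbers of false rows. -/
noncomputable def falseSeries : PowerSeries ℝ := (1 / 2 : ℝ) • rowSeries - gapSeries

lemma constantCoeff_falseSeries : PowerSeries.constantCoeff falseSeries = 0 := by
  simp [falseSeries, PowerSeries.smul_eq_C_mul, constantCoeff_rowSeries, constantCoeff_gapSeries]

lemma falseSeries_eq :
    falseSeries = PowerSeries.X + (rowSeries - falseSeries) * falseSeries := by
  have h1 := gapSeries_eq
  have h2 := rowSeries_eq
  have hC : PowerSeries.C (1 / 4 : ℝ) * 4 = 1 := by
    rw [← map_ofNat PowerSeries.C 4, ← map_mul]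
    norm_num
  have hC2 : PowerSeries.C (1 / 2 : ℝ) = 2 * PowerSeries.C (1 / 4 : ℝ) := by
    rw [← map_ofNat PowerSeries.C 2, ← map_mul]
    norm_num
  rw [falseSeries]
  rw [PowerSeries.smul_eq_C_mul] at h1 ⊢
  rw [hC2]
  set q := PowerSeries.C (1 / 4 : ℝ)
  linear_combination -h1 + 2 * q * h2 + (PowerSeries.X + q * rowSeries ^ 2 - rowSeries * gapSeries) * hC

lemma eq_coeff_falseSeries (f : ℕ → ℤ) (hf0 : f 0 = 0) (hf1 : f 1 = 1)
    (hf : ∀ n : ℕ, 2 ≤ n →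
      f n = ∑ i ∈ Finset.Icc 1 (n - 1),
        ((2 : ℤ) ^ i * catalanC i - f i) * f (n - i)) (n : ℕ) :
    (f n : ℝ) = PowerSeries.coeff n falseSeries := by
  induction n using Nat.strong_induction_on with
  | _ n ih =>
    have hc := constantCoeff_falseSeries
    have hr := constantCoeff_rowSeries
    obtain rfl | rfl | hn : n = 0 ∨ n = 1 ∨ 2 ≤ n := by omega
    · simp [hf0, hc]
    · rw [falseSeries_eq, hf1, map_add, PowerSeries.coeff_mul,
        Finset.Nat.sum_antidiagonal_eq_sum_range_succ_mk]
      simp [Finset.sum_range_succ, hc, hr]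
    · rw [falseSeries_eq, map_add, PowerSeries.coeff_mul,
        Finset.Nat.sum_antidiagonal_eq_sum_range_succ_mk, PowerSeries.coeff_X,
        if_neg (by omega), zero_add, hf n hn]
      push_cast
      refine Eq.trans ?_ (Finset.sum_subset (s₁ := Finset.Icc 1 (n - 1)) ?_ ?_)
      · refine Finset.sum_congr rfl fun i hi => ?_
        rw [Finset.mem_Icc] at hi
        rw [ih i (by omega), ih (n - i) (by omega), map_sub, coeff_rowSeries]
      · intro i hi
        rw [Finset.mem_Icc] at hi
        rw [Finset.mem_range]
        omega
      · intro i hi hi'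
        rw [Finset.mem_range] at hi
        rw [Finset.mem_Icc] at hi'
        obtain rfl | rfl : i = 0 ∨ i = n := by omega
        · simp [hc, hr]
        · simp [hc]

open Filter Topology in
lemma tendsto_coeff_gapSeries_div :
    Tendsto (fun n : ℕ => PowerSeries.coeff (n + 1) gapSeries / (2 ^ (n + 1) * catalanC (n + 1)))
      atTop (𝓝 (1 / (2 * √3))) := by
  have hval : ∑' k : ℕ, (catalanC k : ℝ) * (1 / 4) ^ k * (2 * (2 * k : ℕ) / 2 ^ (2 * k))
      = 1 / (2 * √3) := by
    have hterm (k : ℕ) : (catalanC (k + 1) : ℝ) * (1 / 4) ^ (k + 1)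
        * (2 * (2 * (k + 1) : ℕ) / 2 ^ (2 * (k + 1)))
        = 1 / 4 * (k.centralBinom * (1 / 16) ^ k) := by
      rw [← succ_mul_catalanC_succ, show (1 / 16 : ℝ) = 1 / 4 * (1 / 4) by norm_num, mul_pow,
        pow_mul, div_eq_mul_one_div _ ((2 ^ 2 : ℝ) ^ (k + 1)), ← one_div_pow]
      push_cast
      ring
    rw [tsum_eq_zero_add' (by
      simp_rw [hterm]
      exact summable_centralBinom_div_sixteen_pow.mul_left _)]
    simp_rw [hterm]
    rw [tsum_mul_left, tsum_centralBinom_div_sixteen_pow, catalanC_zero]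
    field_simp
    norm_num
  rw [← hval]
  have hdiv (n : ℕ) :
      PowerSeries.coeff (n + 1) gapSeries / (2 ^ (n + 1) * catalanC (n + 1))
        = ∑' k : ℕ, (catalanC k : ℝ) * (1 / 4) ^ k
          * (PowerSeries.coeff (n + 1) (shiftedCatalan ^ (2 * k)) / catalanC (n + 1)) := by
    rw [coeff_gapSeries, ← tsum_div_const]
    refine tsum_congr fun k => ?_
    have := (catalanC_succ_pos n).ne'
    field_simp
  simp_rw [hdiv]
  refine tendsto_tsum_of_dominated_convergence summable_catalanC_div_four_pow
    (fun k => (tendsto_coeff_shiftedCatalan_pow_div (2 * k)).const_mul _)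
    (Eventually.of_forall fun n k => ?_)
  rcases k with _ | k
  · simp [catalanC_zero]
  · have h0 := coeff_shiftedCatalan_pow_nonneg (n + 1) (2 * (k + 1))
    rw [Real.norm_of_nonneg (by positivity)]
    refine mul_le_of_le_one_right (by positivity) ?_
    rw [div_le_one (catalanC_succ_pos n)]
    exact coeff_shiftedCatalan_pow_succ_le n (2 * k + 1)

open Filter in
/-- `f n` is asymptotically `((3 - √3)/6) * 2^(3n-2) / √(π n³)`:
the ratio tends to `1` as `n → ∞`. -/
theorem false_rows_asymptotics (f : ℕ → ℤ) (hf0 : f 0 = 0) (hf1 : f 1 = 1)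
    (hf : ∀ n : ℕ, 2 ≤ n →
      f n = ∑ i ∈ Finset.Icc 1 (n - 1),
        ((2 : ℤ) ^ i * catalanC i - f i) * f (n - i)) :
    Tendsto
      (fun n : ℕ => (f n : ℝ) * 6 * Real.sqrt (Real.pi * n ^ 3) /
        ((3 - Real.sqrt 3) * 2 ^ (3 * n - 2)))
      atTop (nhds 1) := by
  have hA : Tendsto (fun n : ℕ => (f (n + 1) : ℝ) / (2 ^ (n + 1) * catalanC (n + 1))) atTop
      (nhds (1 / 2 - 1 / (2 * √3))) := by
    refine (tendsto_coeff_gapSeries_div.const_sub (1 / 2)).congr fun n => ?_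
    have := (catalanC_succ_pos n).ne'
    rw [eq_coeff_falseSeries f hf0 hf1 hf, falseSeries, map_sub, map_smul, coeff_rowSeries,
      smul_eq_mul]
    field_simp
  have h3 : √3 ^ 2 = 3 := Real.sq_sqrt (by norm_num)
  have h3' : 3 - √3 ≠ 0 := by
    have : √3 < 3 := by rw [Real.sqrt_lt' (by norm_num)]; norm_num
    linarith
  have hlim := (hA.mul_const (6 / (3 - √3))).mul tendsto_centralBinom_mul_sqrt_div
  have hval : (1 / 2 - 1 / (2 * √3)) * (6 / (3 - √3)) * 1 = 1 := by
    have : √3 ≠ 0 := by positivity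
    field_simp
    linear_combination 2 * h3
  rw [hval] at hlim
  rw [← tendsto_add_atTop_iff_nat 1]
  refine hlim.congr fun n => ?_
  have hsqrt : √(Real.pi * ((n + 1 : ℕ) : ℝ) ^ 3) = (n + 1) * √(Real.pi * (n + 1)) := by
    rw [show Real.pi * ((n + 1 : ℕ) : ℝ) ^ 3 = (n + 1) ^ 2 * (Real.pi * (n + 1)) by
      push_cast; ring, Real.sqrt_mul (by positivity), Real.sqrt_sq (by positivity)]
  have hpow : (2 : ℝ) ^ (3 * (n + 1) - 2) = 2 ^ (n + 1) * 4 ^ n := by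
    rw [show 3 * (n + 1) - 2 = (n + 1) + 2 * n by omega, pow_add, pow_mul]
    norm_num
  have := (catalanC_succ_pos n).ne'
  rw [hsqrt, hpow, ← succ_mul_catalanC_succ]
  field_simp
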